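/- arXiv:2604.06800 — 2 statements merged into one kernel-verified Lean document; each statement's English description precedes it below -/
import Mathlib

section
/- Let a, b, c, d ∈ ℚ satisfy ad − bc ≠ 0, a² + c² = b² + d², and ac = bd. Then a² ≠ b², and there exists σ ∈ {1, −1} such that c = σ·b and d = σ·a (so the matrix has the form (λ, λ̄; σλ̄, σλ) with λ = a, λ̄ = b and λ² ≠ λ̄²). -/
/-- **Statement 8.** (Classification of automorphisms of the Sullivan model of
`ℂP² # (-ℂP²)` in degree 2.) If `a, b, c, d ∈ ℚ` satisfy `ad − bc ≠ 0`,
`a² + c² = b² + d²` and `ac = bd`, then `a² ≠ b²` and there is a sign `σ ∈ {1, −1}`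
such that `c = σ·b` and `d = σ·a`. -/
theorem sullivan_aut_classification (a b c d : ℚ)
    (hdet : a * d - b * c ≠ 0)
    (h1 : a ^ 2 + c ^ 2 = b ^ 2 + d ^ 2)
    (h2 : a * c = b * d) :
    a ^ 2 ≠ b ^ 2 ∧ ∃ σ : ℚ, (σ = 1 ∨ σ = -1) ∧ c = σ * b ∧ d = σ * a := by
  have hsum : (a + c) ^ 2 = (b + d) ^ 2 := by linear_combination h1 + 2 * h2
  have hdiff : (a - c) ^ 2 = (b - d) ^ 2 := by linear_combination h1 - 2 * h2
  have key : ∃ σ : ℚ, (σ = 1 ∨ σ = -1) ∧ c = σ * b ∧ d = σ * a := by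
    rcases sq_eq_sq_iff_eq_or_eq_neg.mp hsum with hs | hs <;>
      rcases sq_eq_sq_iff_eq_or_eq_neg.mp hdiff with ht | ht
    · have hab : a = b := by linarith
      have hcd : c = d := by linarith
      exact absurd (by rw [hab, hcd]; ring) hdet
    · exact ⟨1, Or.inl rfl, by linarith, by linarith⟩
    · exact ⟨-1, Or.inr rfl, by linarith, by linarith⟩
    · have hab : a = -b := by linarith
      have hcd : c = -d := by linarith
      exact absurd (by rw [hab, hcd]; ring) hdet
  refine ⟨fun hab => hdet ?_, key⟩
  obtain ⟨σ, -, rfl, rfl⟩ := key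
  linear_combination σ * hab
end

section
/- Let a, b, c, d ∈ ℚ satisfy ad − bc ≠ 0, a² + c² = b² + d², and ac = bd. Then ad + bc ≠ 0. -/
/-- **Statement 9.** If `a, b, c, d ∈ ℚ` satisfy `ad − bc ≠ 0`, `a² + c² = b² + d²` and
`ac = bd`, then `ad + bc ≠ 0` (the coefficient of `y₂` in the linear part of any
automorphism of the Sullivan model of `ℂP² # (-ℂP²)` is nonzero). -/
theorem coeff_y2_ne_zero (a b c d : ℚ)
    (hdet : a * d - b * c ≠ 0)
    (h1 : a ^ 2 + c ^ 2 = b ^ 2 + d ^ 2)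
    (h2 : a * c = b * d) :
    a * d + b * c ≠ 0 := by
  intro h
  have sum_sq : (a + c) ^ 2 = (b + d) ^ 2 := by linear_combination h1 + 2 * h2
  have diff_sq : (a - c) ^ 2 = (b - d) ^ 2 := by linear_combination h1 - 2 * h2
  apply hdet
  rcases sq_eq_sq_iff_eq_or_eq_neg.mp sum_sq with hs | hs <;>
    rcases sq_eq_sq_iff_eq_or_eq_neg.mp diff_sq with hd | hd
  · obtain rfl : a = b := by linarith
    obtain rfl : c = d := by linarith
    ring
  · obtain rfl : a = d := by linarith
    obtain rfl : c = b := by linarith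
    nlinarith [sq_nonneg a, sq_nonneg c]
  · obtain rfl : d = -a := by linarith
    obtain rfl : b = -c := by linarith
    nlinarith [sq_nonneg a, sq_nonneg c]
  · obtain rfl : b = -a := by linarith
    obtain rfl : d = -c := by linarith
    ring
end
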